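/- For every t ∈ [0,1] and every even integer s ≥ 2, γ_{s,1}(t) := ℙ(D_s(t) ∩ M_1(t)) = (1−t)² e^{−t} ∑_{l=0}^{s/2−1} t^{2l+1}/(2l+1)!. -/

import Mathlib

open MeasureTheory Set

/-- `P` is the infinite product over `ℤ` of the uniform probability measure on `[0,1]`,
characterized by its values on cylinder sets. -/
def IsUniformProduct (P : Measure (ℤ → ℝ)) : Prop :=
  ∀ (F : Finset ℤ) (A : ℤ → Set ℝ), (∀ i ∈ F, MeasurableSet (A i)) →
    P {T | ∀ i ∈ F, T i ∈ A i} = ∏ i ∈ F, (volume.restrict (Icc (0 : ℝ) 1)) (A i)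

/-- The event `G_{jk}^s(t)`. -/
def G (t : ℝ) (s : ℤ) (j k : ℕ) : Set (ℤ → ℝ) :=
  {T | T s < t ∧
    (∀ i : ℕ, i < 2 * j → T (s - i - 1) < T (s - i)) ∧
    T (s - 2 * j) < T (s - 2 * j - 1) ∧
    (∀ i : ℕ, i < 2 * k → T (s + i + 1) < T (s + i)) ∧
    T (s + 2 * k) < T (s + 2 * k + 1)}

/-- The event that site `s` is occupied by time `t`. -/
def O (t : ℝ) (s : ℤ) : Set (ℤ → ℝ) := ⋃ (j : ℕ) (k : ℕ), G t s j k

/-- The event that sites `-1` and `0` are vacant and site `s` is occupied at time `t`. -/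
def D (t : ℝ) (s : ℤ) : Set (ℤ → ℝ) := (O t (-1))ᶜ ∩ (O t 0)ᶜ ∩ O t s

def M1 (t : ℝ) : Set (ℤ → ℝ) := {T | t < T (-1) ∧ t < T 0}
def M2 (t : ℝ) : Set (ℤ → ℝ) := {T | T (-1) < t ∧ T 0 < t}
def M3 (t : ℝ) : Set (ℤ → ℝ) := {T | T (-1) < t ∧ t < T 0}
def M4 (t : ℝ) : Set (ℤ → ℝ) := {T | T 0 < t ∧ t < T (-1)}


noncomputable section

/-- uniform measure -/
abbrev mu : Measure ℝ := volume.restrict (Icc (0 : ℝ) 1)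

instance mu_prob : IsProbabilityMeasure mu := ⟨by simp [mu]⟩

theorem isUniformProduct_eq {P : Measure (ℤ → ℝ)} (hP : IsUniformProduct P) :
    P = Measure.infinitePi (fun _ : ℤ => mu) := by
  apply Measure.eq_infinitePi
  intro F A hA
  rw [← hP F A (fun i _ => hA i)]
  rfl

theorem meas_upd (i : ℤ) : Measurable (fun p : ℝ × (ℤ → ℝ) => Function.update p.2 i p.1) := by
  rw [measurable_pi_iff]
  intro a
  by_cases h : a = i
  · subst h; simpa using measurable_fst
  · simp only [Function.update_of_ne h]
    exact (measurable_pi_apply a).comp measurable_snd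

theorem meas_upd1 (i : ℤ) (y : ℝ) : Measurable (fun T : ℤ → ℝ => Function.update T i y) :=
  (meas_upd i).comp (measurable_const.prodMk measurable_id)

theorem resample {P : Measure (ℤ → ℝ)} (hP : IsUniformProduct P) (i : ℤ)
    {E : Set (ℤ → ℝ)} (hE : MeasurableSet E) :
    P E = ∫⁻ y, P {T | Function.update T i y ∈ E} ∂mu := by
  have hPp : IsProbabilityMeasure P := by
    rw [isUniformProduct_eq hP]; infer_instance
  have key : (mu.prod P).map (fun p : ℝ × (ℤ → ℝ) => Function.update p.2 i p.1) = P := by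
    rw [isUniformProduct_eq (P := (mu.prod P).map _) _, ← isUniformProduct_eq hP]
    intro F A hA
    have hms : MeasurableSet {T : ℤ → ℝ | ∀ i ∈ F, T i ∈ A i} :=
      MeasurableSet.pi F.countable_toSet hA
    rw [Measure.map_apply (meas_upd i) hms]
    by_cases hi : i ∈ F
    · have : (fun p : ℝ × (ℤ → ℝ) => Function.update p.2 i p.1) ⁻¹' {T | ∀ i ∈ F, T i ∈ A i}
          = (A i) ×ˢ {T | ∀ a ∈ F.erase i, T a ∈ A a} := by
        ext ⟨y, T⟩
        simp only [mem_preimage, mem_ofPred_eq, mem_prod, Finset.mem_erase]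
        constructor
        · intro h
          refine ⟨by simpa using h i hi, fun a ha => ?_⟩
          have := h a ha.2
          rwa [Function.update_of_ne ha.1] at this
        · rintro ⟨h1, h2⟩ a ha
          by_cases hai : a = i
          · subst hai; simpa using h1
          · rw [Function.update_of_ne hai]; exact h2 a ⟨hai, ha⟩
      rw [this, Measure.prod_prod, hP _ _ (fun a ha => hA a (Finset.mem_of_mem_erase ha)),
        Finset.mul_prod_erase F (fun a => mu (A a)) hi]
    · have : (fun p : ℝ × (ℤ → ℝ) => Function.update p.2 i p.1) ⁻¹' {T | ∀ i ∈ F, T i ∈ A i}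
          = univ ×ˢ {T | ∀ a ∈ F, T a ∈ A a} := by
        ext ⟨y, T⟩
        simp only [mem_preimage, mem_ofPred_eq, mem_prod, mem_univ, true_and]
        refine forall₂_congr fun a ha => ?_
        rw [Function.update_of_ne (by rintro rfl; exact hi ha)]
      rw [this, Measure.prod_prod, hP _ _ hA, measure_univ, one_mul]
  conv_lhs => rw [← key]
  rw [Measure.map_apply (meas_upd i) hE, Measure.prod_apply (meas_upd i hE)]
  rfl

/-- FTC helper -/
theorem lint_helper (F f : ℝ → ℝ) (hF : ∀ x, HasDerivAt F (f x) x) (hf : Continuous f)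
    (h0 : ∀ x ∈ Icc (0 : ℝ) 1, 0 ≤ f x) (u : ℝ) (hu : u ∈ Icc (0 : ℝ) 1) (b : ENNReal)
    (g : ℝ → ENNReal)
    (hg : ∀ x ∈ Icc (0 : ℝ) 1, g x = if x < u then ENNReal.ofReal (f x) * b else 0) :
    ∫⁻ x, g x ∂mu = ENNReal.ofReal (F u - F 0) * b := by
  have h1 : ∫⁻ x, g x ∂mu
      = ∫⁻ x in Icc (0 : ℝ) 1, (Iio u).indicator (fun x => ENNReal.ofReal (f x) * b) x := by
    apply setLIntegral_congr_fun measurableSet_Icc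
    intro x hx
    simp only [hg x hx, indicator, mem_Iio]
  have hm : Measurable fun x => ENNReal.ofReal (f x) := hf.measurable.ennreal_ofReal
  rw [h1, lintegral_indicator measurableSet_Iio, Measure.restrict_restrict measurableSet_Iio,
    lintegral_mul_const _ hm]
  congr 1
  have h2 : Iio u ∩ Icc 0 1 = Ico 0 u := by
    ext x; simp only [mem_inter_iff, mem_Iio, mem_Icc, mem_Ico]
    constructor
    · rintro ⟨a, b, c⟩; exact ⟨b, a⟩
    · rintro ⟨a, b⟩; exact ⟨b, a, by linarith [hu.2]⟩
  rw [h2, Measure.restrict_congr_set Ico_ae_eq_Ioc, ← ofReal_integral_eq_lintegral_ofReal,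
    ← intervalIntegral.integral_of_le hu.1,
    intervalIntegral.integral_eq_sub_of_hasDerivAt (fun x _ => hF x) (hf.intervalIntegrable _ _)]
  · exact (hf.integrableOn_Icc (a := 0) (b := u)).mono_set Ioc_subset_Icc_self
  · filter_upwards [ae_restrict_mem measurableSet_Ioc] with x hx
    exact h0 x ⟨hx.1.le, hx.2.trans hu.2⟩

/-- chain predicate -/
def Q (n : ℕ) (d : ℕ → ℝ) : Prop := (∀ i < n, d (i + 1) < d i) ∧ d n < d (n + 1)

/-- sequence -/
def dd (c : ℕ → ℤ) (x : ℝ) (T : ℤ → ℝ) : ℕ → ℝ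
  | 0 => x
  | i + 1 => T (c i)

theorem Q_succ (n : ℕ) (d : ℕ → ℝ) :
    Q (n + 1) d ↔ d 1 < d 0 ∧ Q n (fun i => d (i + 1)) := by
  constructor
  · rintro ⟨h1, h2⟩
    exact ⟨h1 0 (by omega), fun i hi => h1 (i + 1) (by omega), h2⟩
  · rintro ⟨h0, h1, h2⟩
    refine ⟨?_, h2⟩
    rintro (_ | i) hi
    · exact h0
    · exact h1 i (by omega)

theorem Q_unique {n m : ℕ} {d : ℕ → ℝ} (h1 : Q n d) (h2 : Q m d) : n = m := by
  rcases lt_trichotomy n m with h | h | h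
  · exact absurd (h2.1 n h) (not_lt.2 h1.2.le)
  · exact h
  · exact absurd (h1.1 m h) (not_lt.2 h2.2.le)

theorem meas_Q (n : ℕ) {α : Type*} [MeasurableSpace α] (d : α → ℕ → ℝ)
    (hd : ∀ i, Measurable fun a => d a i) : MeasurableSet {a | Q n (d a)} := by
  have : {a | Q n (d a)} = (⋂ i, ⋂ (_ : i < n), {a | d a (i + 1) < d a i})
      ∩ {a | d a n < d a (n + 1)} := by
    ext a; simp [Q]
  rw [this]
  exact (MeasurableSet.iInter fun i => MeasurableSet.iInter fun _ =>
    measurableSet_lt (hd _) (hd _)).inter (measurableSet_lt (hd _) (hd _))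

theorem meas_dd (c : ℕ → ℤ) (x : ℝ) (i : ℕ) : Measurable fun T => dd c x T i := by
  cases i with
  | zero => exact measurable_const
  | succ i => exact measurable_pi_apply (c i)

/-- event -/
def E (n : ℕ) (c : ℕ → ℤ) (x : ℝ) : Set (ℤ → ℝ) := {T | Q n (dd c x T)}

theorem meas_E (n : ℕ) (c : ℕ → ℤ) (x : ℝ) : MeasurableSet (E n c x) :=
  meas_Q n _ (meas_dd c x)

/-- density -/
def al (n : ℕ) (x : ℝ) : ℝ := x ^ n / n.factorial - x ^ (n + 1) / (n + 1).factorial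

theorem al_nonneg (n : ℕ) (x : ℝ) (hx : x ∈ Icc (0 : ℝ) 1) : 0 ≤ al n x := by
  unfold al
  rw [sub_nonneg]
  have h1 : x ^ (n + 1) ≤ x ^ n := pow_le_pow_of_le_one hx.1 hx.2 (by omega)
  have h2 : (n.factorial : ℝ) ≤ (n + 1).factorial := by
    exact_mod_cast Nat.factorial_le (by omega)
  have h3 : (0 : ℝ) < n.factorial := by exact_mod_cast n.factorial_pos
  have := hx.1
  gcongr

theorem deriv_term (n : ℕ) (x : ℝ) :
    HasDerivAt (fun x : ℝ => x ^ (n + 1) / (n + 1).factorial) (x ^ n / n.factorial) x := by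
  have h := (hasDerivAt_pow (n + 1) x).div_const ((n + 1).factorial : ℝ)
  refine h.congr_deriv ?_
  rw [Nat.factorial_succ, Nat.add_sub_cancel]
  have h3 : (n.factorial : ℝ) ≠ 0 := by exact_mod_cast n.factorial_ne_zero
  have h4 : ((n : ℝ) + 1) ≠ 0 := by positivity
  push_cast
  field_simp

theorem deriv_al (n : ℕ) (x : ℝ) : HasDerivAt (al (n + 1)) (al n x) x :=
  (deriv_term n x).sub (deriv_term (n + 1) x)

theorem cont_al (n : ℕ) : Continuous (al n) := by
  unfold al; fun_prop

/-- invariance under changing coordinate i -/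
def InvAt (B : Set (ℤ → ℝ)) (i : ℤ) : Prop := ∀ T y, Function.update T i y ∈ B ↔ T ∈ B

theorem E_inv (n : ℕ) (c : ℕ → ℤ) (x : ℝ) (i : ℤ) (h : ∀ m, c m ≠ i) : InvAt (E n c x) i := by
  intro T y
  have : dd c x (Function.update T i y) = dd c x T := by
    funext m
    cases m with
    | zero => rfl
    | succ m => exact Function.update_of_ne (h m) _ _
  simp only [E, mem_ofPred_eq, this]

theorem prob_E {P : Measure (ℤ → ℝ)} (hP : IsUniformProduct P) (n : ℕ) :
    ∀ (c : ℕ → ℤ) (_ : Function.Injective c) (x : ℝ) (_ : x ∈ Icc (0 : ℝ) 1)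
      (B : Set (ℤ → ℝ)) (_ : MeasurableSet B) (_ : ∀ m ≤ n, InvAt B (c m)),
      P (E n c x ∩ B) = ENNReal.ofReal (al n x) * P B := by
  have hPp : IsProbabilityMeasure P := by
    rw [isUniformProduct_eq hP]; infer_instance
  induction n with
  | zero =>
    intro c hc x hx B hB hinv
    rw [resample hP (c 0) ((meas_E 0 c x).inter hB)]
    have h : ∀ y, P {T | Function.update T (c 0) y ∈ E 0 c x ∩ B}
        = (Ioi x).indicator (fun _ => P B) y := by
      intro y
      by_cases hy : x < y
      · rw [indicator_of_mem (by exact hy)]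
        congr 1
        ext T
        simp [E, Q, dd, hy, hinv 0 (Nat.zero_le _) T y]
      · rw [indicator_of_notMem (by exact hy)]
        convert measure_empty (μ := P)
        ext T
        simp [E, Q, dd, hy]
    simp_rw [h]
    rw [lintegral_indicator measurableSet_Ioi, setLIntegral_const, mul_comm]
    congr 1
    rw [Measure.restrict_apply measurableSet_Ioi]
    have h2 : Ioi x ∩ Icc 0 1 = Ioc x 1 := by
      ext y; simp only [mem_inter_iff, mem_Ioi, mem_Icc, mem_Ioc]
      constructor
      · rintro ⟨a, b, c⟩; exact ⟨a, c⟩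
      · rintro ⟨a, b⟩; exact ⟨a, by linarith [hx.1], b⟩
    rw [h2, Real.volume_Ioc]
    simp [al]
  | succ n ih =>
    intro c hc x hx B hB hinv
    rw [resample hP (c 0) ((meas_E (n + 1) c x).inter hB)]
    have := lint_helper (al (n + 1)) (al n) (deriv_al n) (cont_al n) (al_nonneg n) x hx (P B)
      (fun y => P {T | Function.update T (c 0) y ∈ E (n + 1) c x ∩ B}) ?_
    · rw [this]; simp [al]
    intro y hy
    split_ifs with h
    · rw [← ih (fun i => c (i + 1)) (fun a b hab => by simpa using hc hab) y hy B hB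
        (fun m hm => hinv (m + 1) (by omega))]
      congr 1
      ext T
      have : (fun i => dd c x (Function.update T (c 0) y) (i + 1))
          = dd (fun i => c (i + 1)) y T := by
        funext m
        cases m with
        | zero => simp [dd]
        | succ m =>
          simp only [dd]
          exact Function.update_of_ne (fun h => by simpa using hc h) _ _
      simp only [E, mem_inter_iff, mem_ofPred_eq, Q_succ, this, hinv 0 (Nat.zero_le _) T y]
      simp [dd, h]
    · convert measure_empty (μ := P)
      ext T
      simp [E, Q_succ, dd, h]

theorem al_tsum (x : ℝ) : HasSum (fun k : ℕ => al (2 * k) x) (Real.exp (-x)) := by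
  have h := NormedSpace.expSeries_div_hasSum_exp (𝔸 := ℝ) (-x)
  rw [← Real.exp_eq_exp_ℝ] at h
  have h2 := (Equiv.hasSum_iff (Nat.divModEquiv 2).symm).2 h
  have h3 := h2.prod_fiberwise (fun b => hasSum_fintype _)
  refine h3.congr_fun ?_
  intro k
  simp [Fin.sum_univ_two, al, Nat.divModEquiv, mul_comm, pow_succ, pow_mul]
  have h5 : (-1 : ℝ) ^ (k * 2) = 1 := Even.neg_one_pow (by simp)
  ring_nf
  rw [h5]
  ring

/-- right event -/
def Rt (c : ℕ → ℤ) (x : ℝ) : Set (ℤ → ℝ) := ⋃ k : ℕ, E (2 * k) c x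

/-- left event -/
def Lf (m : ℕ) (c : ℕ → ℤ) (x : ℝ) : Set (ℤ → ℝ) := ⋃ j ∈ Finset.range m, E (2 * j) c x

theorem E_disj (c : ℕ → ℤ) (x : ℝ) (B : Set (ℤ → ℝ)) :
    Pairwise (Function.onFun Disjoint fun k : ℕ => E (2 * k) c x ∩ B) := by
  intro j k hjk
  rw [Function.onFun, Set.disjoint_left]
  rintro T ⟨h1, _⟩ ⟨h2, _⟩
  have := Q_unique h1 h2
  omega

theorem prob_Rt {P : Measure (ℤ → ℝ)} (hP : IsUniformProduct P)
    (c : ℕ → ℤ) (hc : Function.Injective c) (x : ℝ) (hx : x ∈ Icc (0 : ℝ) 1)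
      (B : Set (ℤ → ℝ)) (hB : MeasurableSet B) (hinv : ∀ m, InvAt B (c m)) :
      P (Rt c x ∩ B) = ENNReal.ofReal (Real.exp (-x)) * P B := by
  rw [Rt, iUnion_inter, measure_iUnion (E_disj c x B) (fun k => (meas_E _ c x).inter hB)]
  simp_rw [prob_E hP _ c hc x hx B hB (fun m _ => hinv m)]
  rw [ENNReal.tsum_mul_right, ← (al_tsum x).tsum_eq,
    ENNReal.ofReal_tsum_of_nonneg (fun n => al_nonneg _ x hx) (al_tsum x).summable]

theorem prob_Lf {P : Measure (ℤ → ℝ)} (hP : IsUniformProduct P) (m : ℕ)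
    (c : ℕ → ℤ) (B : Set (ℤ → ℝ)) (hB : MeasurableSet B) (x : ℝ) (hx : x ∈ Icc (0 : ℝ) 1)
    (h : ∀ j < m, P (E (2 * j) c x ∩ B) = ENNReal.ofReal (al (2 * j) x) * P B) :
      P (Lf m c x ∩ B) = ENNReal.ofReal (∑ j ∈ Finset.range m, al (2 * j) x) * P B := by
  have : Lf m c x ∩ B = ⋃ j ∈ Finset.range m, (E (2 * j) c x ∩ B) := by
    rw [Lf, iUnion₂_inter]
  rw [this, measure_biUnion_finset (fun i _ j _ hij => E_disj c x B hij)
    (fun k _ => (meas_E _ c x).inter hB),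
    Finset.sum_congr rfl (fun j hj => h j (Finset.mem_range.1 hj)), ← Finset.sum_mul,
    ENNReal.ofReal_sum_of_nonneg (fun n _ => al_nonneg _ x hx)]

theorem prob_M1 {P : Measure (ℤ → ℝ)} (hP : IsUniformProduct P) (t : ℝ)
    (ht : t ∈ Icc (0 : ℝ) 1) : P (M1 t) = ENNReal.ofReal ((1 - t) ^ 2) := by
  have h := hP {-1, 0} (fun _ => Ioi t) (fun _ _ => measurableSet_Ioi)
  have h1 : {T : ℤ → ℝ | ∀ i ∈ ({-1, 0} : Finset ℤ), T i ∈ Ioi t} = M1 t := by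
    ext T; simp [M1]
  rw [h1] at h
  rw [h, Finset.prod_const, Measure.restrict_apply measurableSet_Ioi]
  have h2 : Ioi t ∩ Icc 0 1 = Ioc t 1 := by
    ext y; simp only [mem_inter_iff, mem_Ioi, mem_Icc, mem_Ioc]
    constructor
    · rintro ⟨a, b, c⟩; exact ⟨a, c⟩
    · rintro ⟨a, b⟩; exact ⟨a, by linarith [ht.1], b⟩
  rw [h2, Real.volume_Ioc, ENNReal.ofReal_pow (by linarith [ht.2])]
  rfl

theorem meas_M1 (t : ℝ) : MeasurableSet (M1 t) :=
  (measurableSet_lt measurable_const (measurable_pi_apply _)).inter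
    (measurableSet_lt measurable_const (measurable_pi_apply _))

/-- right sites -/
def cR (s : ℤ) (i : ℕ) : ℤ := s + i + 1

/-- left sites -/
def cL (s : ℤ) (i : ℕ) : ℤ := s - i - 1

theorem mem_G (t : ℝ) (s : ℤ) (j k : ℕ) (T : ℤ → ℝ) : T ∈ G t s j k ↔
    T s < t ∧ T ∈ E (2 * j) (cL s) (T s) ∧ T ∈ E (2 * k) (cR s) (T s) := by
  have hL : ∀ i : ℕ, dd (cL s) (T s) T i = T (s - i) := by
    rintro (_ | i)
    · simp [dd]
    · simp only [dd, cL]; congr 1; push_cast; ring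
  have hR : ∀ i : ℕ, dd (cR s) (T s) T i = T (s + i) := by
    rintro (_ | i)
    · simp [dd]
    · simp only [dd, cR]; congr 1; push_cast; ring
  simp only [G, E, Q, mem_ofPred_eq, hL, hR]
  push_cast
  simp only [← sub_sub, ← add_assoc, and_assoc]

theorem event_eq (t : ℝ) (s : ℕ) (hse : Even s) : D t s ∩ M1 t =
    {T | T s < t ∧ T ∈ Lf (s / 2) (cL s) (T s) ∩ (Rt (cR s) (T s) ∩ M1 t)} := by
  ext T
  simp only [D, O, Lf, Rt, mem_inter_iff, mem_compl_iff, mem_iUnion, mem_ofPred_eq,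
    Finset.mem_range, exists_prop, not_exists]
  constructor
  · rintro ⟨⟨_, j, k, h⟩, hM⟩
    have hg := (mem_G t s j k T).1 h
    refine ⟨hg.1, ⟨j, ?_, hg.2.1⟩, ⟨k, hg.2.2⟩, hM⟩
    by_contra hj
    have hch : ∀ i : ℕ, i ≤ 2 * j → T ((s : ℤ) - i) ≤ T s := by
      intro i
      induction i with
      | zero => simp
      | succ i ih =>
        intro hi
        have := h.2.1 i (by omega)
        have h3 := ih (by omega)
        push_cast
        rw [← sub_sub]
        linarith
    have h4 := hch s (by obtain ⟨r, hr⟩ := hse; omega)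
    rw [sub_self] at h4
    linarith [hM.2, hg.1]
  · rintro ⟨h1, ⟨j, _, hj⟩, ⟨k, hk⟩, hM⟩
    refine ⟨⟨⟨?_, ?_⟩, j, k, (mem_G t s j k T).2 ⟨h1, hj, hk⟩⟩, hM⟩
    · intro a b h; exact absurd h.1 (not_lt.2 hM.1.le)
    · intro a b h; exact absurd h.1 (not_lt.2 hM.2.le)

theorem meas_O (t : ℝ) (s : ℤ) : MeasurableSet (O t s) := by
  refine MeasurableSet.iUnion fun j => MeasurableSet.iUnion fun k => ?_
  have : G t s j k = {T | T s < t} ∩ ({T | Q (2 * j) (dd (cL s) (T s) T)} ∩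
      {T | Q (2 * k) (dd (cR s) (T s) T)}) := by
    ext T; rw [mem_G]; rfl
  rw [this]
  refine (measurableSet_lt (measurable_pi_apply _) measurable_const).inter
    ((meas_Q _ _ ?_).inter (meas_Q _ _ ?_))
  all_goals
    rintro (_ | i)
    · exact measurable_pi_apply s
    · exact measurable_pi_apply _

theorem Lf_inv (m : ℕ) (c : ℕ → ℤ) (x : ℝ) (i : ℤ) (h : ∀ m, c m ≠ i) : InvAt (Lf m c x) i := by
  intro T y
  simp only [Lf, mem_iUnion, E_inv _ c x i h T y]

theorem Rt_inv (c : ℕ → ℤ) (x : ℝ) (i : ℤ) (h : ∀ m, c m ≠ i) : InvAt (Rt c x) i := by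
  intro T y
  simp only [Rt, mem_iUnion, E_inv _ c x i h T y]

theorem M1_inv (t : ℝ) (i : ℤ) (h : i ≠ -1) (h' : i ≠ 0) : InvAt (M1 t) i := by
  intro T y
  simp only [M1, mem_ofPred_eq, Function.update_of_ne h.symm, Function.update_of_ne h'.symm]

theorem deriv_main (m : ℕ) (x : ℝ) :
    HasDerivAt (fun x : ℝ => Real.exp (-x) *
        ∑ l ∈ Finset.range m, x ^ (2 * l + 1) / ((2 * l + 1).factorial : ℝ))
      (Real.exp (-x) * ∑ j ∈ Finset.range m, al (2 * j) x) x := by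
  have h1 : HasDerivAt (fun x : ℝ => ∑ l ∈ Finset.range m,
      x ^ (2 * l + 1) / ((2 * l + 1).factorial : ℝ))
      (∑ l ∈ Finset.range m, x ^ (2 * l) / ((2 * l).factorial : ℝ)) x :=
    HasDerivAt.fun_sum fun l _ => deriv_term (2 * l) x
  have h2 : HasDerivAt (fun x : ℝ => Real.exp (-x)) (-Real.exp (-x)) x := by
    simpa using (hasDerivAt_neg x).exp
  refine (h2.mul h1).congr_deriv ?_
  simp only [al, Finset.sum_sub_distrib]
  ring

end

theorem gamma_one (P : Measure (ℤ → ℝ)) (hP : IsUniformProduct P)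
    (t : ℝ) (ht : t ∈ Icc (0 : ℝ) 1) (s : ℕ) (hs : 2 ≤ s) (hse : Even s) :
    (P (D t s ∩ M1 t)).toReal =
      (1 - t) ^ 2 * Real.exp (-t) *
        ∑ l ∈ Finset.range (s / 2), t ^ (2 * l + 1) / (Nat.factorial (2 * l + 1)) := by
  have hs0 : (2 : ℤ) ≤ s := by exact_mod_cast hs
  have hmeas : MeasurableSet (D t s ∩ M1 t) :=
    (((meas_O _ _).compl.inter (meas_O _ _).compl).inter (meas_O _ _)).inter (meas_M1 t)
  have key : P (D t s ∩ M1 t) = ENNReal.ofReal ((Real.exp (-t) *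
        ∑ l ∈ Finset.range (s / 2), t ^ (2 * l + 1) / ((2 * l + 1).factorial : ℝ))
        - (Real.exp (-0) *
        ∑ l ∈ Finset.range (s / 2), 0 ^ (2 * l + 1) / ((2 * l + 1).factorial : ℝ)))
        * P (M1 t) := by
    rw [resample hP s hmeas]
    refine lint_helper _ _ (deriv_main (s / 2)) ?_ ?_ t ht _ _ ?_
    · have := cont_al
      fun_prop
    · intro x hx
      have := Finset.sum_nonneg (fun j (_ : j ∈ Finset.range (s / 2)) => al_nonneg (2 * j) x hx)
      positivity
    intro x hx
    have hMs : InvAt (M1 t) s := M1_inv t s (by omega) (by omega)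
    have hRm : MeasurableSet (Rt (cR s) x) := MeasurableSet.iUnion fun k => meas_E _ _ _
    have hset : {T : ℤ → ℝ | Function.update T s x ∈ D t s ∩ M1 t} =
        {T | x < t ∧ T ∈ Lf (s / 2) (cL s) x ∩ (Rt (cR s) x ∩ M1 t)} := by
      ext T
      rw [event_eq t s hse]
      simp only [mem_ofPred_eq, mem_inter_iff, Function.update_self]
      rw [hMs T x, Lf_inv _ _ x s (fun m => by simp only [cL]; omega) T x,
        Rt_inv _ x s (fun m => by simp only [cR]; omega) T x]
    rw [hset]
    split_ifs with hxt
    · simp only [hxt, true_and, ofPred_mem_eq]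
      rw [prob_Lf hP (s / 2) (cL s) _ (hRm.inter (meas_M1 t)) x hx,
        prob_Rt hP (cR s) _ x hx _ (meas_M1 t), ← mul_assoc, ← ENNReal.ofReal_mul, mul_comm (Real.exp _)]
      · exact Finset.sum_nonneg (fun j _ => al_nonneg (2 * j) x hx)
      · intro m
        exact M1_inv t _ (by simp only [cR]; omega) (by simp only [cR]; omega)
      · intro a b h
        simp only [cR] at h; omega
      · intro j hj
        apply prob_E hP _ _ _ x hx _ (hRm.inter (meas_M1 t))
        · intro m hm T y
          rw [mem_inter_iff, mem_inter_iff,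
            M1_inv t _ (by simp only [cL]; omega) (by simp only [cL]; omega) T y,
            Rt_inv _ x _ (fun m => by simp only [cL, cR]; omega) T y]
        · intro a b h
          simp only [cL] at h; omega
    · simp [hxt]
  have hnn : 0 ≤ ∑ l ∈ Finset.range (s / 2), t ^ (2 * l + 1) / ((2 * l + 1).factorial : ℝ) :=
    Finset.sum_nonneg fun l _ => by have := ht.1; positivity
  rw [key, prob_M1 hP t ht, ENNReal.toReal_mul, ENNReal.toReal_ofReal, ENNReal.toReal_ofReal]
  · simp
    ring
  · positivity
  · simp
    positivity
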